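/- arXiv:1212.3722 — 2 statements merged into one kernel-verified Lean document; each statement's English description precedes it below -/
import Mathlib

section
/- (Equivariance theorem.) Let K be a field, E and F finite-dimensional K-vector spaces, u an endomorphism of E, v an endomorphism of F, and j : E → F an injective linear map satisfying j ∘ u = v ∘ j. If α ∈ K is an eigenvalue of u, then α is an eigenvalue of v, and j ∘ π_{E,α}(u) = π_{F,α}(v) ∘ j, where π_{E,α}(u) and π_{F,α}(v) denote the characteristic projections of u and v at α. -/
open Polynomial

theorem LinearMap.comp_aeval_eq_aeval_comp {R M N : Type*} [CommSemiring R]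
    [AddCommMonoid M] [Module R M] [AddCommMonoid N] [Module R N]
    {f : Module.End R M} {g : Module.End R N} {j : M →ₗ[R] N} (h : j ∘ₗ f = g ∘ₗ j) (p : R[X]) :
    j ∘ₗ aeval f p = aeval g p ∘ₗ j := by
  induction p using Polynomial.induction_on' with
  | add p q hp hq => rw [map_add, map_add, LinearMap.comp_add, LinearMap.add_comp, hp, hq]
  | monomial n a =>
    have hpow : j ∘ₗ (f ^ n) = (g ^ n) ∘ₗ j :=
      (Module.End.commute_pow_left_of_commute h.symm n).symm
    ext x
    simpa [aeval_monomial] using congrArg (a • ·) (LinearMap.congr_fun hpow x)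

theorem Polynomial.isCoprime_X_sub_C_of_eval_ne_zero {K : Type*} [Field K] {a : K} {p : K[X]}
    (h : p.eval a ≠ 0) : IsCoprime (X - C a) p :=
  (irreducible_X_sub_C a).coprime_iff_not_dvd.2 fun hd => h (dvd_iff_isRoot.1 hd)

/-- Equivariance theorem: if `j : E → F` is injective and intertwines `u` and `v`
(`j ∘ u = v ∘ j`), and `α` is an eigenvalue of `u`, then `α` is an eigenvalue of `v` and
`j ∘ π_{E,α}(u) = π_{F,α}(v) ∘ j`, where the characteristic projections are computed from
the minimal polynomials `(X - α)^νu * Qu` of `u` and `(X - α)^νv * Qv` of `v` together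
with Bézout pairs. -/
theorem characteristic_projection_equivariance
    {K : Type*} [Field K] {E F : Type*} [AddCommGroup E] [Module K E]
    [AddCommGroup F] [Module K F] [FiniteDimensional K E] [FiniteDimensional K F]
    (u : Module.End K E) (v : Module.End K F) (j : E →ₗ[K] F)
    (hj : Function.Injective j) (hint : j ∘ₗ u = v ∘ₗ j)
    (α : K) (hα : Module.End.HasEigenvalue u α)
    (νu : ℕ) (hνu : 1 ≤ νu) (Qu Au Bu : K[X]) (hQu : Qu.eval α ≠ 0)
    (hminu : minpoly K u = (X - C α) ^ νu * Qu)
    (hbezu : (X - C α) ^ νu * Au + Qu * Bu = 1)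
    (νv : ℕ) (Qv Av Bv : K[X]) (hQv : Qv.eval α ≠ 0)
    (hminv : minpoly K v = (X - C α) ^ νv * Qv)
    (hbezv : (X - C α) ^ νv * Av + Qv * Bv = 1) :
    Module.End.HasEigenvalue v α ∧
    j ∘ₗ (aeval u (Qu * Bu)) = (aeval v (Qv * Bv)) ∘ₗ j := by
  have haeval := LinearMap.comp_aeval_eq_aeval_comp hint
  refine ⟨?_, ?_⟩
  · obtain ⟨x, hx⟩ := hα.exists_hasEigenvector
    refine Module.End.hasEigenvalue_of_hasEigenvector (x := j x)
      ⟨Module.End.mem_eigenspace_iff.2 ?_, (map_ne_zero_iff j hj).2 hx.2⟩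
    rw [← LinearMap.comp_apply, ← hint, LinearMap.comp_apply, hx.apply_eq_smul, map_smul]
  have hdvd : (X - C α) ^ νu * Qu ∣ (X - C α) ^ νv * Qv := by
    rw [← hminu, ← hminv]
    refine minpoly.dvd K u ((LinearMap.cancel_left hj).1 ?_)
    rw [haeval, minpoly.aeval, LinearMap.zero_comp, LinearMap.comp_zero]
  have hQ : Qu ∣ Qv :=
    ((isCoprime_X_sub_C_of_eval_ne_zero hQu).symm.pow_right).dvd_of_dvd_mul_left
      ((dvd_mul_left _ _).trans hdvd)
  have hX : (X - C α) ^ νu ∣ (X - C α) ^ νv :=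
    ((isCoprime_X_sub_C_of_eval_ne_zero hQv).pow_left).dvd_of_dvd_mul_right
      ((dvd_mul_right _ _).trans hdvd)
  have hmin : minpoly K u ∣ Qu * Bu - Qv * Bv := by
    rw [hminu]
    refine (isCoprime_X_sub_C_of_eval_ne_zero hQu).pow_left.mul_dvd ?_ ?_
    · have hsub : Qu * Bu - Qv * Bv = (X - C α) ^ νv * Av - (X - C α) ^ νu * Au := by
        linear_combination hbezu - hbezv
      rw [hsub]
      exact dvd_sub (hX.mul_right _) (dvd_mul_right _ _)
    · exact dvd_sub (dvd_mul_right _ _) (hQ.mul_right _)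
  have hproj : aeval u (Qu * Bu) = aeval u (Qv * Bv) := by
    rw [← sub_eq_zero, ← map_sub]
    exact (minpoly.dvd_iff).1 hmin
  rw [hproj, haeval]
end

section
/- Let K be a field, E a finite-dimensional K-vector space decomposed as an internal direct sum E = ⊕_{i ∈ I} E_i of u-stable subspaces, where u is an endomorphism of E, and let α ∈ K be an eigenvalue of u. Then the characteristic projection π_{E,α}(u) maps each E_i into itself, and for every i such that α is an eigenvalue of the restriction u|_{E_i}, the restriction of π_{E,α}(u) to E_i equals the characteristic projection π_{E_i,α}(u|_{E_i}); for every i such that α is not an eigenvalue of u|_{E_i}, π_{E,α}(u) vanishes on E_i. Hence π_{E,α}(u) is obtained by gluing the blockwise characteristic projections. -/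
open Polynomial

/-- The idempotents `Q * B` and `Q' * B'` attached to the root `a` of two polynomials
`(X - C a) ^ m * Q` and `(X - C a) ^ n * Q'` agree modulo the second one if it divides the first. -/
theorem dvd_bezout_idempotent_sub {K : Type*} [Field K] {a : K} {m n : ℕ}
    {Q A B Q' A' B' : K[X]} (hQ : Q.eval a ≠ 0) (hQ' : Q'.eval a ≠ 0)
    (hdvd : (X - C a) ^ n * Q' ∣ (X - C a) ^ m * Q)
    (hbez : (X - C a) ^ m * A + Q * B = 1) (hbez' : (X - C a) ^ n * A' + Q' * B' = 1) :
    (X - C a) ^ n * Q' ∣ Q * B - Q' * B' := by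
  have coprime {P : K[X]} (hP : P.eval a ≠ 0) : IsCoprime (X - C a) P :=
    (irreducible_X_sub_C a).coprime_iff_not_dvd.2 fun h => hP (dvd_iff_isRoot.1 h)
  have hpow : (X - C a) ^ n ∣ (X - C a) ^ m :=
    (coprime hQ).pow_left.dvd_of_dvd_mul_right ((dvd_mul_right _ _).trans hdvd)
  have hcof : Q' ∣ Q :=
    (coprime hQ').symm.pow_right.dvd_of_dvd_mul_left ((dvd_mul_left _ _).trans hdvd)
  refine (coprime hQ').pow_left.mul_dvd ?_ ?_
  · have : Q * B - Q' * B' = (X - C a) ^ n * A' - (X - C a) ^ m * A := by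
      linear_combination hbez - hbez'
    rw [this]
    exact dvd_sub (dvd_mul_right _ _) (hpow.mul_right _)
  · exact dvd_sub (hcof.mul_right _) (dvd_mul_right _ _)

theorem coe_aeval_restrict_apply {R M : Type*} [CommRing R] [AddCommGroup M] [Module R M]
    {N : Submodule R M} {f : Module.End R M} (hf : ∀ x ∈ N, f x ∈ N) (p : R[X]) (x : N) :
    (aeval (f.restrict hf) p x : M) = aeval f p x := by
  induction p using Polynomial.induction_on' with
  | add p q hp hq => simp [hp, hq]
  | monomial n r =>
    simp [aeval_monomial, Module.algebraMap_end_apply, Module.End.pow_restrict n]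

/-- Gluing: if `E = ⊕ᵢ Eᵢ` is an internal direct sum of `u`-stable subspaces and `α` is an
eigenvalue of `u`, then the characteristic projection `π_{E,α}(u) = Q(u) ∘ B(u)` maps each
`Eᵢ` into itself; on each `Eᵢ` where `α` is an eigenvalue of `u|_{Eᵢ}` it restricts to the
characteristic projection of the restriction (computed from any minimal-polynomial
factorization and Bézout pair), and on each `Eᵢ` where `α` is not an eigenvalue of
`u|_{Eᵢ}` it vanishes. -/
theorem characteristic_projection_glues
    {K : Type*} [Field K] {E : Type*} [AddCommGroup E] [Module K E]
    [FiniteDimensional K E] {I : Type*} [Fintype I] [DecidableEq I]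
    (Ei : I → Submodule K E) (hdec : DirectSum.IsInternal Ei)
    (u : Module.End K E) (hstab : ∀ i, ∀ x ∈ Ei i, u x ∈ Ei i)
    (α : K) (hα : Module.End.HasEigenvalue u α)
    (ν : ℕ) (hν : 1 ≤ ν) (Q A B : K[X]) (hQ : Q.eval α ≠ 0)
    (hmin : minpoly K u = (X - C α) ^ ν * Q)
    (hbez : (X - C α) ^ ν * A + Q * B = 1) :
    (∀ i, ∀ x ∈ Ei i, (aeval u (Q * B)) x ∈ Ei i) ∧
    (∀ i, Module.End.HasEigenvalue (u.restrict (hstab i)) α →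
      ∀ (νi : ℕ), 1 ≤ νi → ∀ (Qi Ai Bi : K[X]), Qi.eval α ≠ 0 →
        minpoly K (u.restrict (hstab i)) = (X - C α) ^ νi * Qi →
        (X - C α) ^ νi * Ai + Qi * Bi = 1 →
        ∀ x : Ei i,
          (aeval u (Q * B)) (x : E) = ((aeval (u.restrict (hstab i)) (Qi * Bi)) x : E)) ∧
    (∀ i, ¬ Module.End.HasEigenvalue (u.restrict (hstab i)) α →
      ∀ x ∈ Ei i, (aeval u (Q * B)) x = 0) := by
  have hdvd (i : I) : minpoly K (u.restrict (hstab i)) ∣ (X - C α) ^ ν * Q := by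
    refine minpoly.dvd K _ (LinearMap.ext fun x => Subtype.ext ?_)
    rw [coe_aeval_restrict_apply, ← hmin, minpoly.aeval]
    simp
  have agree (i : I) {n : ℕ} {Q' A' B' : K[X]} (hQ' : Q'.eval α ≠ 0)
      (hmin' : minpoly K (u.restrict (hstab i)) = (X - C α) ^ n * Q')
      (hbez' : (X - C α) ^ n * A' + Q' * B' = 1) (x : Ei i) :
      aeval u (Q * B) (x : E) = (aeval (u.restrict (hstab i)) (Q' * B') x : E) := by
    have h := dvd_bezout_idempotent_sub hQ hQ' (hmin' ▸ hdvd i) hbez hbez'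
    rw [← hmin', minpoly.dvd_iff, map_sub, sub_eq_zero] at h
    rw [← coe_aeval_restrict_apply (hstab i), h]
  refine ⟨fun i x hx => ?_, fun i _ νi _ Qi Ai Bi hQi hmini hbezi => agree i hQi hmini hbezi,
    fun i hi x hx => ?_⟩
  · rw [← coe_aeval_restrict_apply (hstab i) _ ⟨x, hx⟩]
    exact Subtype.prop _
  · simpa using agree i (n := 0) (A' := 1) (B' := 0)
      (fun h => hi (Module.End.hasEigenvalue_of_isRoot h)) (by simp) (by simp) ⟨x, hx⟩
end
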